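/- Let n ≥ 1 and let M = e^{-V} be a positive C² function on ℝⁿ with M ∈ L¹(ℝⁿ), and assume there exists ε > 0 such that (1-ε)|∇V(x)|²/2 - ΔV(x) → +∞ as |x| → ∞. Let α ∈ (0,2). Then there exists a constant λ_α > 0 such that for every f ∈ C_c^∞(ℝⁿ) with ∫_{ℝⁿ} f(x) M(x) dx = 0, one has ∬_{ℝⁿ×ℝⁿ} |f(x)-f(y)|² / |x-y|^{n+α} · M(x) dx dy ≥ λ_α ∫_{ℝⁿ} |f(x)|² M(x) dx. -/

import Mathlib

open MeasureTheory Filter Real Set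

/-- The Laplacian of a function on `EuclideanSpace ℝ (Fin n)`, defined as the sum of the
second derivatives in the coordinate directions. -/
noncomputable def laplacian {n : ℕ} (V : EuclideanSpace ℝ (Fin n) → ℝ)
    (x : EuclideanSpace ℝ (Fin n)) : ℝ :=
  ∑ i : Fin n, fderiv ℝ (fun y => fderiv ℝ V y (EuclideanSpace.single i 1)) x
    (EuclideanSpace.single i 1)


/-- positive-part gluing -/
noncomputable def glue (g : ℝ → ℝ) (t : ℝ) : ℝ := if 0 ≤ t then g t else 0

lemma glue_hasDerivAt {g g' : ℝ → ℝ} (h : ∀ t, HasDerivAt g (g' t) t) (h0 : g 0 = 0)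
    (h0' : g' 0 = 0) (t : ℝ) : HasDerivAt (glue g) (glue g' t) t := by
  rcases lt_trichotomy t 0 with ht | ht | ht
  · have : glue g =ᶠ[nhds t] fun _ => 0 := by
      filter_upwards [Iio_mem_nhds ht] with s hs
      simp [glue, not_le.2 (show s < 0 from hs)]
    have e : glue g' t = 0 := by simp [glue, not_le.2 ht]
    rw [e]
    exact (hasDerivAt_const t (0:ℝ)).congr_of_eventuallyEq this
  · subst ht
    have e : glue g' 0 = 0 := by simp [glue, h0']
    rw [e]
    have h1 : HasDerivWithinAt (glue g) 0 (Ici 0) 0 := by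
      have := (h 0).hasDerivWithinAt (s := Ici 0)
      rw [h0'] at this
      refine this.congr (fun x hx => ?_) ?_
      · have hx' : (0:ℝ) ≤ x := hx
        simp [glue, hx']
      · simp [glue]
    have h2 : HasDerivWithinAt (glue g) 0 (Iic 0) 0 := by
      refine (hasDerivWithinAt_const (0:ℝ) (Iic 0) (0:ℝ)).congr (fun x hx => ?_) ?_
      · rcases (show x ≤ 0 from hx).lt_or_eq with hx | hx
        · simp [glue, not_le.2 hx]
        · simp [glue, hx, h0]
      · simp [glue, h0]
    have := h1.union h2
    rw [Ici_union_Iic, ] at this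
    exact hasDerivWithinAt_univ.1 this
  · have : glue g =ᶠ[nhds t] g := by
      filter_upwards [Ioi_mem_nhds ht] with s hs
      simp [glue, (show (0:ℝ) < s from hs).le]
    have e : glue g' t = g' t := by simp [glue, ht.le]
    rw [e]
    exact (h t).congr_of_eventuallyEq this

noncomputable def g0 (t : ℝ) : ℝ := t - arctan t
noncomputable def g1 (t : ℝ) : ℝ := t ^ 2 / (1 + t ^ 2)
noncomputable def g2 (t : ℝ) : ℝ := 2 * t / (1 + t ^ 2) ^ 2

lemma g0_deriv (t : ℝ) : HasDerivAt g0 (g1 t) t := by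
  have := (hasDerivAt_id t).sub (hasDerivAt_arctan t)
  refine this.congr_deriv ?_
  have : 1 + t ^ 2 ≠ 0 := by positivity
  unfold g1
  field_simp
  ring

lemma g1_deriv (t : ℝ) : HasDerivAt g1 (g2 t) t := by
  have h : 1 + t ^ 2 ≠ 0 := by positivity
  have h1 : HasDerivAt (fun t : ℝ => t ^ 2) (2 * t) t := by simpa using hasDerivAt_pow 2 t
  have := h1.div (h1.const_add 1) h
  refine this.congr_deriv ?_
  unfold g2
  field_simp
  ring

lemma G_deriv (t : ℝ) : HasDerivAt (glue g0) (glue g1 t) t :=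
  glue_hasDerivAt g0_deriv (by simp [g0]) (by simp [g1]) t
lemma G1_deriv (t : ℝ) : HasDerivAt (glue g1) (glue g2 t) t :=
  glue_hasDerivAt g1_deriv (by simp [g1]) (by simp [g2]) t
lemma G_cont : Continuous (glue g0) :=
  continuous_iff_continuousAt.2 fun t => (G_deriv t).continuousAt
lemma G1_cont : Continuous (glue g1) :=
  continuous_iff_continuousAt.2 fun t => (G1_deriv t).continuousAt
lemma G2_cont : Continuous (glue g2) := by
  have : glue g2 = fun t => g2 (max t 0) := by
    ext t
    rcases le_total 0 t with h | h
    · simp [glue, h]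
    · rcases h.lt_or_eq with h' | h'
      · simp [glue, not_le.2 h', max_eq_right h, g2]
      · simp [glue, h']
  rw [this]
  unfold g2
  refine Continuous.div (by fun_prop) (by fun_prop) (fun t => by positivity)
lemma G2_nonneg (t : ℝ) : 0 ≤ glue g2 t := by
  unfold glue; split_ifs with h
  · unfold g2; positivity
  · rfl
lemma G1_nonneg (t : ℝ) : 0 ≤ glue g1 t := by
  unfold glue; split_ifs with h
  · unfold g1; positivity
  · rfl
lemma G1_pos {t : ℝ} (h : 0 < t) : 0 < glue g1 t := by
  simp only [glue, h.le, if_true]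
  unfold g1; positivity
lemma G1_zero {t : ℝ} (h : t ≤ 0) : glue g1 t = 0 := by
  rcases h.lt_or_eq with h | h
  · simp [glue, not_le.2 h]
  · simp [glue, h, g1]
lemma G_abs_le (t m : ℝ) (h : t ≤ m) (hm : 0 ≤ m) : |glue g0 t| ≤ m := by
  unfold glue; split_ifs with h0
  · unfold g0
    have h1 : 0 ≤ arctan t := arctan_nonneg.2 h0
    have h2 : arctan t ≤ t := by
      rcases h0.lt_or_eq with h0 | h0
      · have := Real.lt_tan (Real.arctan_pos.2 h0) (Real.arctan_lt_pi_div_two t)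
        rw [Real.tan_arctan] at this
        exact this.le
      · simp [← h0]
    rw [abs_le]; constructor <;> linarith
  · simpa using hm

section
variable {n : ℕ}

lemma ibp (e : EuclideanSpace ℝ (Fin n)) (f f' g g' : EuclideanSpace ℝ (Fin n) → ℝ)
    (hf : ∀ x, HasLineDerivAt ℝ f (f' x) x e) (hg : ∀ x, HasLineDerivAt ℝ g (g' x) x e)
    (cf : Continuous f) (cf' : Continuous f') (cg : Continuous g) (cg' : Continuous g')
    (sf : HasCompactSupport f) (sf' : HasCompactSupport f') :
    ∫ x, f x * g' x = - ∫ x, f' x * g x := by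
  have := integral_bilinear_hasLineDerivAt_right_eq_neg_left_of_integrable (μ := volume)
    (B := ContinuousLinearMap.mul ℝ ℝ) (f := f) (f' := f') (g := g) (g' := g') (v := e)
    ((cf'.mul cg).integrable_of_hasCompactSupport (sf'.mul_right))
    ((cf.mul cg').integrable_of_hasCompactSupport (sf.mul_right))
    ((cf.mul cg).integrable_of_hasCompactSupport (sf.mul_right))
    (fun x _ => hf x) (fun x _ => hg x)
  simpa using this

lemma ibp_part (e : EuclideanSpace ℝ (Fin n)) (u u1 u2 c c1 c2 : EuclideanSpace ℝ (Fin n) → ℝ)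
    (hu : ∀ x, HasLineDerivAt ℝ u (u1 x) x e) (hu1 : ∀ x, HasLineDerivAt ℝ u1 (u2 x) x e)
    (hc : ∀ x, HasLineDerivAt ℝ c (c1 x) x e) (hc1 : ∀ x, HasLineDerivAt ℝ c1 (c2 x) x e)
    (cu : Continuous u) (cu1 : Continuous u1) (cu2 : Continuous u2)
    (cc : Continuous c) (cc1 : Continuous c1) (cc2 : Continuous c2)
    (sc : HasCompactSupport c) (sc1 : HasCompactSupport c1) (sc2 : HasCompactSupport c2)
    (c0 : ∀ x, 0 ≤ c x) :
    ∫ x, c x * glue g1 (u x) * u2 x ≤ ∫ x, c2 x * glue g0 (u x) := by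
  have k0 : Continuous (fun x => glue g0 (u x)) := G_cont.comp cu
  have k1 : Continuous (fun x => glue g1 (u x)) := G1_cont.comp cu
  have k2 : Continuous (fun x => glue g2 (u x)) := G2_cont.comp cu
  have d0 : ∀ x, HasLineDerivAt ℝ (fun x => glue g0 (u x)) (glue g1 (u x) * u1 x) x e := by
    intro x
    have h := hu x
    unfold HasLineDerivAt at h ⊢
    exact HasDerivAt.comp (h₂ := glue g0) (0:ℝ) (by simpa using G_deriv (u x)) h
  have d1 : ∀ x, HasLineDerivAt ℝ (fun x => glue g1 (u x)) (glue g2 (u x) * u1 x) x e := by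
    intro x
    have h := hu x
    unfold HasLineDerivAt at h ⊢
    exact HasDerivAt.comp (h₂ := glue g1) (0:ℝ) (by simpa using G1_deriv (u x)) h
  have d2 : ∀ x, HasLineDerivAt ℝ (fun x => c x * glue g1 (u x))
      (c1 x * glue g1 (u x) + c x * (glue g2 (u x) * u1 x)) x e := by
    intro x
    have h := hc x
    have h' := d1 x
    unfold HasLineDerivAt at h h' ⊢
    refine (HasDerivAt.mul h h').congr_deriv ?_
    simp
  have e1 := ibp e _ _ u1 u2 d2 hu1 (cc.mul k1)
    ((cc1.mul k1).add (cc.mul (k2.mul cu1))) cu1 cu2 sc.mul_right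
    (sc1.mul_right.add sc.mul_right)
  have e2 := ibp e c1 c2 _ _ hc1 d0 cc1 cc2 k0 (k1.mul cu1) sc1 sc2
  rw [e1]
  have e3 : ∫ x, c2 x * glue g0 (u x) = - ∫ x, c1 x * (glue g1 (u x) * u1 x) := by
    rw [e2]; simp
  rw [e3, neg_le_neg_iff]
  refine integral_mono ((cc1.mul (k1.mul cu1)).integrable_of_hasCompactSupport sc1.mul_right)
    (Continuous.integrable_of_hasCompactSupport
      (((cc1.mul k1).add (cc.mul (k2.mul cu1))).mul cu1)
      (HasCompactSupport.mul_right (sc1.mul_right.add sc.mul_right))) (fun x => ?_)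
  have := mul_nonneg (mul_nonneg (c0 x) (G2_nonneg (u x))) (mul_self_nonneg (u1 x))
  simp only
  nlinarith

lemma lineDeriv_of_contDiff {f : EuclideanSpace ℝ (Fin n) → ℝ} (hf : ContDiff ℝ 2 f)
    (e : EuclideanSpace ℝ (Fin n)) :
    (∀ x, HasLineDerivAt ℝ f (fderiv ℝ f x e) x e) ∧
    (∀ x, HasLineDerivAt ℝ (fun y => fderiv ℝ f y e)
      (fderiv ℝ (fun y => fderiv ℝ f y e) x e) x e) ∧
    Continuous (fun x => fderiv ℝ f x e) ∧
    Continuous (fun x => fderiv ℝ (fun y => fderiv ℝ f y e) x e) := by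
  have h1 : ContDiff ℝ 1 (fun y => fderiv ℝ f y e) :=
    (hf.fderiv_right (m := 1) (by norm_num)).clm_apply contDiff_const
  refine ⟨fun x => ?_, fun x => ?_, h1.continuous, ?_⟩
  · exact (hf.differentiable (by norm_num) x).hasFDerivAt.hasLineDerivAt e
  · exact (h1.differentiable (by norm_num) x).hasFDerivAt.hasLineDerivAt e
  · exact (h1.continuous_fderiv (by norm_num)).clm_apply continuous_const

lemma max_principle (u M : EuclideanSpace ℝ (Fin n) → ℝ)
    (hu : ContDiff ℝ 2 u) (hM : Integrable M) (hM0 : ∀ x, 0 ≤ M x) (huM : ∀ x, u x ≤ M x)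
    (hpos : ∀ x, 0 < u x → 0 < ∑ i : Fin n,
      fderiv ℝ (fun y => fderiv ℝ u y (EuclideanSpace.single i 1)) x
    (EuclideanSpace.single i 1)) : ∀ x, u x ≤ 0 := by
  by_contra! hx
  obtain ⟨x0, hx0⟩ := hx
  let φ : ContDiffBump (0 : EuclideanSpace ℝ (Fin n)) := ⟨1, 2, by norm_num, by norm_num⟩
  have hφ : ContDiff ℝ 2 φ := φ.contDiff
  have sφ : HasCompactSupport φ := φ.hasCompactSupport
  let e : Fin n → EuclideanSpace ℝ (Fin n) := fun i => EuclideanSpace.single i 1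
  let D1 : Fin n → EuclideanSpace ℝ (Fin n) → ℝ := fun i x => fderiv ℝ φ x (e i)
  let D2 : Fin n → EuclideanSpace ℝ (Fin n) → ℝ := fun i x => fderiv ℝ (D1 i) x (e i)
  let U2 : Fin n → EuclideanSpace ℝ (Fin n) → ℝ := fun i x =>
    fderiv ℝ (fun y => fderiv ℝ u y (e i)) x (e i)
  have sD1 : ∀ i, HasCompactSupport (D1 i) := fun i => sφ.fderiv_apply ℝ (e i)
  have sD2 : ∀ i, HasCompactSupport (D2 i) := fun i => (sD1 i).fderiv_apply ℝ (e i)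
  have cU : ∀ i, Continuous (U2 i) := fun i => (lineDeriv_of_contDiff hu (e i)).2.2.2
  have cD2 : ∀ i, Continuous (D2 i) := fun i => (lineDeriv_of_contDiff hφ (e i)).2.2.2
  have comp : ∀ (s : ℝ), s ≠ 0 → ∀ g : EuclideanSpace ℝ (Fin n) → ℝ, HasCompactSupport g →
      HasCompactSupport (fun x => g (s • x)) := by
    intro s hs g hg
    exact hg.comp_homeomorph (Homeomorph.smulOfNeZero s hs)
  let h : EuclideanSpace ℝ (Fin n) → ℝ := fun x => glue g1 (u x) * ∑ i, U2 i x
  have ch : Continuous h := (G1_cont.comp hu.continuous).mul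
    (continuous_finsetSum _ fun i _ => cU i)
  have h0 : ∀ x, 0 ≤ h x := by
    intro x
    rcases le_or_gt (u x) 0 with hx | hx
    · simp [h, G1_zero hx]
    · exact mul_nonneg (G1_nonneg _) (hpos x hx).le
  have hpx : 0 < h x0 := mul_pos (G1_pos hx0) (hpos x0 hx0)
  choose C hC using fun i => (sD2 i).exists_bound_of_continuous (cD2 i)
  -- key estimate
  have key : ∀ s : ℝ, s ≠ 0 → ∫ x, φ (s • x) * h x ≤ s ^ 2 * ((∑ i, C i) * ∫ x, M x) := by
    intro s hs
    have each : ∀ i, ∫ x, φ (s • x) * glue g1 (u x) * U2 i x ≤ s ^ 2 * (C i * ∫ x, M x) := by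
      intro i
      obtain ⟨a1, a2, a3, a4⟩ := lineDeriv_of_contDiff hu (e i)
      obtain ⟨b1, b2, b3, b4⟩ := lineDeriv_of_contDiff hφ (e i)
      have sc : ∀ (g g' : EuclideanSpace ℝ (Fin n) → ℝ),
          (∀ x, HasLineDerivAt ℝ g (g' x) x (e i)) →
          ∀ x, HasLineDerivAt ℝ (fun x => g (s • x)) (s * g' (s • x)) x (e i) := by
        intro g g' hg x
        have h1 := hg (s • x)
        unfold HasLineDerivAt at h1 ⊢
        have h2 : HasDerivAt (fun t : ℝ => s * t) s 0 := by
          simpa using (hasDerivAt_id (0:ℝ)).const_mul s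
        have h3 := HasDerivAt.comp (h₂ := fun t : ℝ => g (s • x + t • e i)) (0:ℝ)
          (by simpa using h1) h2
        refine (h3.congr_deriv (mul_comm _ _)).congr_of_eventuallyEq ?_
        refine Eventually.of_forall fun t => ?_
        simp [smul_add, smul_smul]
      have p1 := sc _ _ b1
      have p2 := sc _ _ b2
      have cs : Continuous (fun x : EuclideanSpace ℝ (Fin n) => s • x) := continuous_const_smul s
      have := ibp_part (e i) u _ _ (fun x => φ (s • x)) (fun x => s * D1 i (s • x))
        (fun x => s * (s * D2 i (s • x))) a1 a2 p1 (fun x => (p2 x).const_mul s)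
        hu.continuous a3 a4 (φ.continuous.comp cs) (continuous_const.mul (b3.comp cs))
        (continuous_const.mul (continuous_const.mul (b4.comp cs)))
        (comp s hs _ sφ) (HasCompactSupport.mul_left (comp s hs _ (sD1 i)))
        (HasCompactSupport.mul_left (HasCompactSupport.mul_left (comp s hs _ (sD2 i))))
        (fun x => φ.nonneg)
      refine this.trans ?_
      rw [← integral_const_mul, ← integral_const_mul]
      refine integral_mono ?_ ((hM.const_mul _).const_mul _) fun x => ?_
      · refine Continuous.integrable_of_hasCompactSupport ?_ ?_
        · exact (continuous_const.mul (continuous_const.mul (b4.comp cs))).mul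
            (G_cont.comp hu.continuous)
        · exact (HasCompactSupport.mul_left (HasCompactSupport.mul_left
            (comp s hs _ (sD2 i)))).mul_right
      · have q1 := hC i (s • x)
        rw [Real.norm_eq_abs] at q1
        have q2 := G_abs_le (u x) (M x) (huM x) (hM0 x)
        have q3 : D2 i (s • x) * glue g0 (u x) ≤ C i * M x := by
          refine (le_abs_self _).trans ?_
          rw [abs_mul]
          exact mul_le_mul q1 q2 (abs_nonneg _) ((abs_nonneg _).trans q1)
        have := mul_le_mul_of_nonneg_left q3 (sq_nonneg s)
        simp only
        nlinarith
    calc ∫ x, φ (s • x) * h x = ∑ i, ∫ x, φ (s • x) * glue g1 (u x) * U2 i x := by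
          rw [← integral_finsetSum]
          · congr 1; ext x; simp only [h, Finset.mul_sum, mul_assoc]
          · intro i _
            refine Continuous.integrable_of_hasCompactSupport ?_ ?_
            · exact ((φ.continuous.comp (continuous_const_smul s)).mul
                (G1_cont.comp hu.continuous)).mul (cU i)
            · exact ((comp s hs _ sφ).mul_right).mul_right
      _ ≤ ∑ i, s ^ 2 * (C i * ∫ x, M x) := Finset.sum_le_sum fun i _ => each i
      _ = _ := by rw [← Finset.mul_sum, Finset.sum_mul]
  obtain ⟨s0, hs0, hs0'⟩ : ∃ s0 : ℝ, 0 < s0 ∧ s0 * ‖x0‖ ≤ 1 := by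
    refine ⟨1 / (1 + ‖x0‖), by positivity, ?_⟩
    rw [div_mul_eq_mul_div, div_le_one (by positivity)]; linarith
  have cont : ∀ s : ℝ, Continuous (fun x => φ (s • x) * h x) := fun s =>
    (φ.continuous.comp (continuous_const_smul s)).mul ch
  have I0 : 0 < ∫ x, φ (s0 • x) * h x := by
    refine Continuous.integral_pos_of_hasCompactSupport_nonneg_nonzero (x := x0) (cont s0)
      ((comp s0 hs0.ne' _ sφ).mul_right) (fun x => mul_nonneg φ.nonneg (h0 x)) ?_
    rw [φ.one_of_mem_closedBall]
    · simpa using hpx.ne'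
    · simp [norm_smul, abs_of_pos hs0]; exact hs0'
  have mono : ∀ s : ℝ, 0 < s → s ≤ s0 / 2 →
      ∫ x, φ (s0 • x) * h x ≤ ∫ x, φ (s • x) * h x := by
    intro s hs hss
    refine integral_mono
      ((cont s0).integrable_of_hasCompactSupport ((comp s0 hs0.ne' _ sφ).mul_right))
      ((cont s).integrable_of_hasCompactSupport ((comp s hs.ne' _ sφ).mul_right)) fun x => ?_
    refine mul_le_mul_of_nonneg_right ?_ (h0 x)
    rcases le_or_gt 2 (s0 * ‖x‖) with hx | hx
    · rw [φ.zero_of_le_dist]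
      · exact φ.nonneg
      · simpa [norm_smul, abs_of_pos hs0] using hx
    · rw [φ.one_of_mem_closedBall (x := s • x)]
      · exact φ.le_one
      · simp [norm_smul, abs_of_pos hs]
        show s * ‖x‖ ≤ 1
        nlinarith [norm_nonneg x]
  have lim : Tendsto (fun s : ℝ => s ^ 2 * ((∑ i, C i) * ∫ x, M x)) (nhdsWithin 0 (Ioi 0))
      (nhds 0) := by
    have : Continuous (fun s : ℝ => s ^ 2 * ((∑ i, C i) * ∫ x, M x)) := by fun_prop
    simpa using (this.tendsto 0).mono_left nhdsWithin_le_nhds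
  have : ∫ x, φ (s0 • x) * h x ≤ 0 := by
    refine ge_of_tendsto lim ?_
    filter_upwards [Ioc_mem_nhdsGT (half_pos hs0)] with s hs
    exact (mono s hs.1 hs.2).trans (key s hs.1.ne')
  linarith
end
noncomputable def japW {n : ℕ} (k : ℕ) (x : EuclideanSpace ℝ (Fin n)) : ℝ :=
  ((1 + ‖x‖ ^ 2) ^ k)⁻¹

lemma japW_pos {n : ℕ} (k : ℕ) (x : EuclideanSpace ℝ (Fin n)) : 0 < japW k x := by
  unfold japW; positivity

lemma japW_contDiff {n : ℕ} (k : ℕ) : ContDiff ℝ 2 (japW (n := n) k) := by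
  unfold japW
  refine ContDiff.inv ?_ (fun x => by positivity)
  exact (contDiff_const.add (contDiff_norm_sq ℝ)).pow k

lemma coord_lineDeriv {n : ℕ} (i : Fin n) (x : EuclideanSpace ℝ (Fin n)) :
    HasLineDerivAt ℝ (fun y : EuclideanSpace ℝ (Fin n) => y i) 1 x (EuclideanSpace.single i 1) := by
  unfold HasLineDerivAt
  simpa using (hasDerivAt_id (0:ℝ)).const_add (x i)

lemma japW_lineDeriv {n : ℕ} (k : ℕ) (i : Fin n) (x : EuclideanSpace ℝ (Fin n)) :
    HasLineDerivAt ℝ (japW (n := n) k) (-(2 * k) * x i * japW (k + 1) x) x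
      (EuclideanSpace.single i 1) := by
  have hq : HasDerivAt (fun t : ℝ => 1 + ‖x + t • EuclideanSpace.single i (1:ℝ)‖ ^ 2)
      (2 * x i) 0 := by
    have : (fun t : ℝ => 1 + ‖x + t • EuclideanSpace.single i (1:ℝ)‖ ^ 2)
        = fun t : ℝ => 1 + ‖x‖ ^ 2 + 2 * x i * t + t ^ 2 := by
      ext t
      rw [norm_add_sq_real, inner_smul_right, norm_smul]
      simp [EuclideanSpace.inner_single_right]
      ring
    rw [this]
    have h1 : HasDerivAt (fun t : ℝ => t ^ 2) 0 0 := by simpa using hasDerivAt_pow 2 (0:ℝ)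
    have h2 : HasDerivAt (fun t : ℝ => 2 * x i * t) (2 * x i) 0 := by
      simpa using (hasDerivAt_id (0:ℝ)).const_mul (2 * x i)
    exact ((h2.const_add (1 + ‖x‖ ^ 2)).fun_add h1).congr_deriv (by simp)
  unfold HasLineDerivAt
  have h3 := (hq.fun_pow k).fun_inv (by positivity)
  refine h3.congr_deriv ?_
  simp only [zero_smul, add_zero, japW]
  have : (1 + ‖x‖ ^ 2) ≠ 0 := by positivity
  rcases k with _ | k
  · simp
  · simp only [Nat.add_sub_cancel]
    field_simp
    ring

lemma fderiv_eq_of_line {n : ℕ} {f : EuclideanSpace ℝ (Fin n) → ℝ}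
    {x e : EuclideanSpace ℝ (Fin n)} {d : ℝ}
    (hf : DifferentiableAt ℝ f x) (h : HasLineDerivAt ℝ f d x e) : fderiv ℝ f x e = d := by
  have := hf.hasFDerivAt.hasLineDerivAt e
  exact HasDerivAt.unique this h

lemma norm_gradient_sq {n : ℕ} (V : EuclideanSpace ℝ (Fin n) → ℝ) (x : EuclideanSpace ℝ (Fin n)) :
    ‖gradient V x‖ ^ 2 = ∑ i : Fin n, (fderiv ℝ V x (EuclideanSpace.single i 1)) ^ 2 := by
  rw [EuclideanSpace.norm_sq_eq]
  refine Finset.sum_congr rfl fun i _ => ?_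
  have : fderiv ℝ V x (EuclideanSpace.single i 1) = gradient V x i := by
    rw [← toDual_gradient, InnerProductSpace.toDual_apply_apply]
    rw [EuclideanSpace.inner_single_right]
    simp
  rw [this, Real.norm_eq_abs, sq_abs]

lemma M_decay {n : ℕ} (V M : EuclideanSpace ℝ (Fin n) → ℝ)
    (hV : ContDiff ℝ 2 V)
    (hM : ∀ x, M x = Real.exp (-V x))
    (hMint : Integrable M)
    (hconf : ∃ ε > (0:ℝ), Tendsto
      (fun x => (1 - ε) * ‖gradient V x‖ ^ 2 / 2 - laplacian V x)
      (cocompact (EuclideanSpace ℝ (Fin n))) atTop) (m : ℕ) :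
    ∃ C > (0:ℝ), ∀ x, M x * (1 + ‖x‖ ^ 2) ^ m ≤ C := by
  obtain ⟨ε, hε, hT⟩ := hconf
  have hMpos : ∀ x, 0 < M x := fun x => by rw [hM]; exact Real.exp_pos _
  have hMfun : M = fun x => Real.exp (-V x) := funext hM
  have cM : ContDiff ℝ 2 M := by rw [hMfun]; exact Real.contDiff_exp.comp hV.neg
  set K : ℝ := 4 * m * (m + 1) + 1 with hK
  obtain ⟨t, ht, htK⟩ := mem_cocompact.1 (hT.eventually_ge_atTop K)
  have cMW : Continuous (fun x => M x * (1 + ‖x‖ ^ 2) ^ m) :=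
    cM.continuous.mul (by fun_prop)
  obtain ⟨B, hB⟩ := ht.exists_bound_of_continuousOn cMW.continuousOn
  set C : ℝ := max B 1 with hC
  have hC0 : 0 < C := lt_of_lt_of_le one_pos (le_max_right _ _)
  refine ⟨C, hC0, ?_⟩
  set u : EuclideanSpace ℝ (Fin n) → ℝ := fun x => M x - C * japW m x with hu
  have cu : ContDiff ℝ 2 u := cM.sub (contDiff_const.mul (japW_contDiff m))
  suffices H : ∀ x, u x ≤ 0 by
    intro x
    have h1 := H x
    have h2 : M x ≤ C * japW m x := by simp only [hu] at h1; linarith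
    unfold japW at h2
    rwa [← div_eq_mul_inv, le_div_iff₀ (by positivity)] at h2
  refine max_principle u M cu hMint (fun x => (hMpos x).le) (fun x => ?_) (fun x hx => ?_)
  · have := mul_pos hC0 (japW_pos m x)
    simp only [hu]; linarith
  have hxt : x ∉ t := by
    intro hxt
    have h1 := (le_abs_self _).trans ((hB x hxt).trans (le_max_left B 1))
    have h2 : M x ≤ C * japW m x := by
      unfold japW
      rwa [← div_eq_mul_inv, le_div_iff₀ (by positivity)]
    simp only [hu] at hx; linarith
  have hconfx : K ≤ (1 - ε) * ‖gradient V x‖ ^ 2 / 2 - laplacian V x := htK hxt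
  have hcx : K ≤ ‖gradient V x‖ ^ 2 - laplacian V x := by
    nlinarith [sq_nonneg ‖gradient V x‖]
  -- the second derivatives of u
  have der : ∀ i : Fin n, fderiv ℝ (fun y => fderiv ℝ u y (EuclideanSpace.single i 1)) x
      (EuclideanSpace.single i 1) =
      M x * ((fderiv ℝ V x (EuclideanSpace.single i 1)) ^ 2 -
        fderiv ℝ (fun y => fderiv ℝ V y (EuclideanSpace.single i 1)) x
          (EuclideanSpace.single i 1))
      - C * (-(2 * m) * japW (m + 1) x + 4 * m * (m + 1) * (x i) ^ 2 * japW (m + 2) x) := by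
    intro i
    set e : EuclideanSpace ℝ (Fin n) := EuclideanSpace.single i 1 with he
    obtain ⟨a1, a2, a3, a4⟩ := lineDeriv_of_contDiff hV e
    have dM : ∀ y, HasLineDerivAt ℝ M (-(M y * fderiv ℝ V y e)) y e := by
      intro y
      have h := a1 y
      rw [hMfun]
      unfold HasLineDerivAt at h ⊢
      refine h.neg.exp.congr_deriv ?_
      simp
    have du : ∀ y, HasLineDerivAt ℝ u
        (-(M y * fderiv ℝ V y e) - C * (-(2 * m) * y i * japW (m + 1) y)) y e := by
      intro y
      have h1 := dM y
      have h2 := japW_lineDeriv m i y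
      unfold HasLineDerivAt at h1 h2 ⊢
      exact h1.sub (h2.const_mul C)
    have eq1 : (fun y => fderiv ℝ u y e) = fun y =>
        (-(M y * fderiv ℝ V y e) - C * (-(2 * m) * y i * japW (m + 1) y)) := by
      ext y
      exact fderiv_eq_of_line (cu.differentiable (by norm_num) y) (du y)
    have h1 : ContDiff ℝ 1 (fun y => fderiv ℝ u y e) :=
      (cu.fderiv_right (m := 1) (by norm_num)).clm_apply contDiff_const
    refine fderiv_eq_of_line (h1.differentiable (by norm_num) x) ?_
    rw [eq1]
    have b1 := dM x
    have b2 := a2 x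
    have b3 := japW_lineDeriv (m + 1) i x
    have b4 := coord_lineDeriv i x
    unfold HasLineDerivAt at b1 b2 b3 b4 ⊢
    refine ((b1.mul b2).neg.sub (((b4.const_mul (-(2 * m) : ℝ)).mul b3).const_mul C)).congr_deriv ?_
    simp only [zero_smul, add_zero]
    push_cast
    ring
  simp_rw [der]
  rw [Finset.sum_sub_distrib, ← Finset.mul_sum, ← Finset.mul_sum, Finset.sum_sub_distrib,
    ← norm_gradient_sq, Finset.sum_add_distrib, Finset.sum_const, ← Finset.sum_mul, ← Finset.mul_sum]
  have hs : ∑ i, x i ^ 2 = ‖x‖ ^ 2 := by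
    rw [EuclideanSpace.norm_sq_eq]; simp
  rw [hs]
  change 0 < M x * (‖gradient V x‖ ^ 2 - laplacian V x) - _
  simp only [Finset.card_univ, Fintype.card_fin, nsmul_eq_mul]
  have k1 : M x * K ≤ M x * (‖gradient V x‖ ^ 2 - laplacian V x) :=
    mul_le_mul_of_nonneg_left hcx (hMpos x).le
  have k2 : 0 ≤ (n : ℝ) * (2 * m * japW (m + 1) x) := by
    have := (japW_pos (m+1) x).le
    positivity
  have k3 : ‖x‖ ^ 2 * japW (m + 2) x < japW m x := by
    unfold japW
    rw [← div_eq_mul_inv, div_lt_iff₀ (by positivity), pow_add, inv_mul_cancel_left₀ (by positivity)]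
    nlinarith [sq_nonneg ‖x‖, norm_nonneg x, sq_nonneg (‖x‖^2)]
  have k4 : C * japW m x < M x := by simp only [hu] at hx; linarith
  have k5 : C * (‖x‖ ^ 2 * japW (m + 2) x) ≤ M x :=
    (mul_le_mul_of_nonneg_left k3.le hC0.le).trans k4.le
  have k6 : (0:ℝ) ≤ 4 * m * (m + 1) := by positivity
  have k7 := mul_le_mul_of_nonneg_left k5 k6
  have k8 := mul_nonneg hC0.le k2
  have k9 := hMpos x
  rw [hK] at k1
  nlinarith
lemma ker_integrable {n : ℕ} (hn : 1 ≤ n) (α : ℝ) (hα : α ∈ Set.Ioo (0:ℝ) 2) :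
    Integrable (fun z : EuclideanSpace ℝ (Fin n) =>
      min 1 (‖z‖ ^ 2) / ‖z‖ ^ ((n : ℝ) + α)) := by
  have : Nontrivial (EuclideanSpace ℝ (Fin n)) := by
    have : Nonempty (Fin n) := ⟨⟨0, hn⟩⟩
    infer_instance
  have hcast : ((n - 1 : ℕ) : ℝ) = (n : ℝ) - 1 := by
    rw [Nat.cast_sub hn]; simp
  refine (integrable_fun_norm_addHaar (volume : Measure (EuclideanSpace ℝ (Fin n)))
    (f := fun r : ℝ => min 1 (r ^ 2) / r ^ ((n : ℝ) + α))).2 ?_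
  rw [finrank_euclideanSpace_fin, ← Ioc_union_Ioi_eq_Ioi (zero_le_one (α := ℝ))]
  refine IntegrableOn.union ?_ ?_
  · have h := (intervalIntegral.intervalIntegrable_rpow' (a := 0) (b := 1) (r := 1 - α)
      (by linarith [hα.2]))
    rw [intervalIntegrable_iff_integrableOn_Ioc_of_le zero_le_one] at h
    refine h.congr_fun (fun r hr => ?_) measurableSet_Ioc
    have hr0 : 0 < r := hr.1
    have hm : min 1 (r ^ 2) = r ^ 2 := min_eq_right (pow_le_one₀ hr0.le hr.2)
    simp only [hm, smul_eq_mul]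
    rw [← Real.rpow_natCast r (n - 1), ← Real.rpow_natCast r 2, ← Real.rpow_sub hr0,
      ← Real.rpow_add hr0, hcast]
    congr 1; push_cast; ring
  · have h := integrableOn_Ioi_rpow_of_lt (a := -1 - α) (c := 1) (by linarith [hα.1]) one_pos
    refine h.congr_fun (fun r hr => ?_) measurableSet_Ioi
    have hr1 : 1 < r := hr
    have hr0 : 0 < r := by linarith
    have hm : min 1 (r ^ 2) = 1 := min_eq_left (one_le_pow₀ hr1.le)
    simp only [hm, smul_eq_mul]
    rw [← Real.rpow_natCast r (n - 1), one_div, ← Real.rpow_neg hr0.le,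
      ← Real.rpow_add hr0, hcast]
    congr 1; ring

lemma F_integrable {n : ℕ} (hn : 1 ≤ n) (α : ℝ) (hα : α ∈ Set.Ioo (0:ℝ) 2)
    (M f : EuclideanSpace ℝ (Fin n) → ℝ) (hM : Integrable M) (hM0 : ∀ x, 0 ≤ M x)
    (cM : Continuous M)
    (hf : ContDiff ℝ (⊤ : ℕ∞) f) (sf : HasCompactSupport f) :
    Integrable (fun p : EuclideanSpace ℝ (Fin n) × EuclideanSpace ℝ (Fin n) =>
      |f p.1 - f p.2| ^ 2 / ‖p.1 - p.2‖ ^ ((n : ℝ) + α) * M p.1) (volume.prod volume) := by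
  obtain ⟨L, hL⟩ := ContDiff.lipschitzWith_of_hasCompactSupport sf hf (by simp)
  obtain ⟨B, hB⟩ := sf.exists_bound_of_continuous hf.continuous
  have cf := hf.continuous
  set A : ℝ := max ((2 * B) ^ 2) ((L : ℝ) ^ 2) with hA
  have hA0 : 0 ≤ A := (sq_nonneg _).trans (le_max_left _ _)
  have h := (Integrable.convolution_integrand (ContinuousLinearMap.mul ℝ ℝ) hM
    ((ker_integrable hn α hα).const_mul A)).swap
  refine h.mono' ?_ (Eventually.of_forall fun p => ?_)
  · refine Measurable.aestronglyMeasurable ?_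
    have := cf.measurable
    have := cM.measurable
    fun_prop
  · obtain ⟨x, y⟩ := p
    simp only [Function.comp, Prod.swap, ContinuousLinearMap.mul_apply']
    have hF : |f x - f y| ^ 2 ≤ A * min 1 (‖x - y‖ ^ 2) := by
      have hx := hB x
      have hy := hB y
      have h1 : |f x - f y| ≤ 2 * B := by
        have := norm_sub_le (f x) (f y)
        rw [Real.norm_eq_abs] at this
        linarith
      have h2 : |f x - f y| ≤ L * ‖x - y‖ := by
        have := hL.dist_le_mul x y
        rwa [Real.dist_eq, dist_eq_norm] at this
      rcases min_choice 1 (‖x - y‖ ^ 2) with h | h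
      · rw [h, mul_one]
        exact (pow_le_pow_left₀ (abs_nonneg _) h1 2).trans (le_max_left _ _)
      · rw [h]
        refine (pow_le_pow_left₀ (abs_nonneg _) h2 2).trans ?_
        rw [mul_pow]
        exact mul_le_mul_of_nonneg_right (le_max_right _ _) (sq_nonneg _)
    have hr : 0 ≤ ‖x - y‖ ^ ((n : ℝ) + α) := Real.rpow_nonneg (norm_nonneg _) _
    rw [Real.norm_of_nonneg (mul_nonneg (div_nonneg (sq_nonneg _) hr) (hM0 x)),
      norm_sub_rev y x, mul_comm]
    refine mul_le_mul_of_nonneg_left ?_ (hM0 x)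
    rw [← mul_div_assoc]
    exact div_le_div_of_nonneg_right hF hr

/-- Fractional Poincaré inequality (corollary of Theorem 1 of the paper): the Gagliardo-type
double integral controls the `L²(M)` norm of a zero-average function. -/
theorem fractional_poincare {n : ℕ} (hn : 1 ≤ n)
    (V M : EuclideanSpace ℝ (Fin n) → ℝ)
    (hV : ContDiff ℝ 2 V)
    (hM : ∀ x, M x = Real.exp (-V x))
    (hMint : Integrable M)
    (hconf : ∃ ε > (0:ℝ), Tendsto
      (fun x => (1 - ε) * ‖gradient V x‖ ^ 2 / 2 - laplacian V x)
      (cocompact (EuclideanSpace ℝ (Fin n))) atTop)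
    (α : ℝ) (hα : α ∈ Set.Ioo (0:ℝ) 2) :
    ∃ lam > (0:ℝ),
      ∀ f : EuclideanSpace ℝ (Fin n) → ℝ,
        ContDiff ℝ (⊤ : ℕ∞) f → HasCompactSupport f →
        (∫ x, f x * M x) = 0 →
        (∫ x, ∫ y, |f x - f y| ^ 2 / ‖x - y‖ ^ ((n : ℝ) + α) * M x)
          ≥ lam * ∫ x, |f x| ^ 2 * M x := by
  have hMpos : ∀ x, 0 < M x := fun x => by rw [hM]; exact Real.exp_pos _
  have cM : Continuous M := by
    rw [funext hM]; exact Real.continuous_exp.comp hV.continuous.neg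
  have hMtot : 0 < ∫ x, M x :=
    integral_pos_of_integrable_nonneg_nonzero (x := 0) cM hMint (fun x => (hMpos x).le)
      (hMpos 0).ne'
  obtain ⟨C, hC, hdec⟩ := M_decay V M hV hM hMint hconf (n + 1)
  -- the pointwise kernel bound
  set c : ℝ := 4 ^ (n + 1) * C with hc
  have hc0 : 0 < c := by positivity
  have hker : ∀ x y, ‖x - y‖ ^ ((n : ℝ) + α) * (M x * M y) ≤ c * (M x + M y) := by
    intro x y
    set a : ℝ := 1 + ‖x‖ ^ 2 with ha
    set b : ℝ := 1 + ‖y‖ ^ 2 with hb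
    have ha0 : 0 < a := by positivity
    have hb0 : 0 < b := by positivity
    have h1 : ‖x - y‖ ^ ((n : ℝ) + α) ≤ (1 + ‖x - y‖ ^ 2) ^ (n + 1) := by
      have e1 : ‖x - y‖ ≤ (1 + ‖x - y‖ ^ 2) ^ (1 / 2 : ℝ) := by
        rw [← Real.sqrt_eq_rpow]
        exact Real.le_sqrt_of_sq_le (by linarith)
      calc ‖x - y‖ ^ ((n : ℝ) + α)
          ≤ ((1 + ‖x - y‖ ^ 2) ^ (1 / 2 : ℝ)) ^ ((n : ℝ) + α) :=
            Real.rpow_le_rpow (norm_nonneg _) e1 (by have := hα.1; positivity)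
        _ = (1 + ‖x - y‖ ^ 2) ^ ((1 / 2 : ℝ) * ((n : ℝ) + α)) :=
            (Real.rpow_mul (by positivity) _ _).symm
        _ ≤ (1 + ‖x - y‖ ^ 2) ^ (((n + 1 : ℕ)) : ℝ) := by
            refine Real.rpow_le_rpow_of_exponent_le (by nlinarith [sq_nonneg ‖x - y‖]) ?_
            push_cast
            have := hα.2
            have : (0:ℝ) ≤ n := Nat.cast_nonneg n
            linarith
        _ = _ := Real.rpow_natCast _ _
    have h2 : 1 + ‖x - y‖ ^ 2 ≤ 4 * max a b := by
      have := norm_sub_le x y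
      have h3 : ‖x - y‖ ^ 2 ≤ (‖x‖ + ‖y‖) ^ 2 := pow_le_pow_left₀ (norm_nonneg _) this 2
      have := le_max_left a b
      have := le_max_right a b
      nlinarith [sq_nonneg (‖x‖ - ‖y‖)]
    have h3 : (1 + ‖x - y‖ ^ 2) ^ (n + 1) ≤ 4 ^ (n + 1) * (a ^ (n + 1) + b ^ (n + 1)) := by
      refine (pow_le_pow_left₀ (by positivity) h2 _).trans ?_
      rw [mul_pow]
      refine mul_le_mul_of_nonneg_left ?_ (by positivity)
      have := pow_pos ha0 (n + 1)
      have := pow_pos hb0 (n + 1)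
      rcases max_choice a b with h | h <;> rw [h] <;> linarith
    have h4 := mul_le_mul_of_nonneg_right (h1.trans h3) (mul_pos (hMpos x) (hMpos y)).le
    refine h4.trans ?_
    have h5 := mul_le_mul_of_nonneg_right (hdec x) (hMpos y).le
    have h6 := mul_le_mul_of_nonneg_right (hdec y) (hMpos x).le
    have h7 : (0:ℝ) ≤ 4 ^ (n + 1) := by positivity
    have h8 := mul_le_mul_of_nonneg_left (add_le_add h5 h6) h7
    rw [hc]
    linarith
  refine ⟨(∫ x, M x) / c, by positivity, ?_⟩
  intro f hf sf hmean
  have hI := F_integrable hn α hα M f hMint (fun x => (hMpos x).le) cM hf sf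
  have cf := hf.continuous
  set F : EuclideanSpace ℝ (Fin n) × EuclideanSpace ℝ (Fin n) → ℝ := fun p =>
      |f p.1 - f p.2| ^ 2 / ‖p.1 - p.2‖ ^ ((n : ℝ) + α) * M p.1 with hF
  have e1 : (∫ x, ∫ y, |f x - f y| ^ 2 / ‖x - y‖ ^ ((n : ℝ) + α) * M x)
      = ∫ p, F p ∂(volume.prod volume) := (integral_prod F hI).symm
  have e2 : ∫ p, F p.swap ∂(volume.prod volume) = ∫ p, F p ∂(volume.prod volume) :=
    integral_prod_swap F
  have hI' : Integrable (fun p => F p.swap) (volume.prod volume) := hI.swap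
  have i1 : Integrable (fun x => f x * M x) :=
    (cf.mul cM).integrable_of_hasCompactSupport sf.mul_right
  have i2 : Integrable (fun x => f x ^ 2 * M x) :=
    ((cf.pow 2).mul cM).integrable_of_hasCompactSupport
      (HasCompactSupport.mul_right (by simpa [pow_two] using sf.mul_right))
  have j1 := i2.mul_prod hMint
  have j2 := hMint.mul_prod i2
  have j3 := i1.mul_prod i1
  have e3 : ∫ p : EuclideanSpace ℝ (Fin n) × EuclideanSpace ℝ (Fin n),
      ((f p.1 ^ 2 * M p.1 * M p.2 + M p.1 * (f p.2 ^ 2 * M p.2))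
        - 2 * (f p.1 * M p.1 * (f p.2 * M p.2))) ∂(volume.prod volume)
      = 2 * ((∫ x, f x ^ 2 * M x) * ∫ x, M x) := by
    have j12 : Integrable (fun p : EuclideanSpace ℝ (Fin n) × EuclideanSpace ℝ (Fin n) =>
        f p.1 ^ 2 * M p.1 * M p.2 + M p.1 * (f p.2 ^ 2 * M p.2)) (volume.prod volume) :=
      j1.add j2
    rw [integral_sub j12 (j3.const_mul 2), integral_add j1 j2, integral_const_mul,
      integral_prod_mul (fun x => f x ^ 2 * M x) M, integral_prod_mul M (fun x => f x ^ 2 * M x),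
      integral_prod_mul (fun x => f x * M x) (fun x => f x * M x), hmean]
    ring
  have e4 : 2 * ((∫ x, f x ^ 2 * M x) * ∫ x, M x)
      ≤ ∫ p, c * (F p + F p.swap) ∂(volume.prod volume) := by
    rw [← e3]
    refine integral_mono ((j1.add j2).sub (j3.const_mul 2)) ((hI.add hI').const_mul c) ?_
    rintro ⟨x, y⟩
    simp only [hF, Prod.swap]
    rw [norm_sub_rev y x, abs_sub_comm (f y) (f x), ← mul_add]
    rcases eq_or_ne x y with hxy | hxy
    · subst hxy
      simp
      nlinarith
    · have hr : 0 < ‖x - y‖ ^ ((n : ℝ) + α) :=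
        Real.rpow_pos_of_pos (norm_pos_iff.2 (sub_ne_zero.2 hxy)) _
      have h1 := mul_le_mul_of_nonneg_left (hker x y) (sq_nonneg |f x - f y|)
      have h2 : f x ^ 2 * M x * M y + M x * (f y ^ 2 * M y) - 2 * (f x * M x * (f y * M y))
        = |f x - f y| ^ 2 * (M x * M y) := by rw [sq_abs]; ring
      rw [h2, div_mul_eq_mul_div, ← mul_div_assoc,
        le_div_iff₀ hr]
      linarith
  rw [integral_const_mul, integral_add hI hI', e2] at e4
  rw [e1]
  simp only [sq_abs]
  rw [ge_iff_le, div_mul_eq_mul_div, div_le_iff₀ hc0]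
  linarith
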